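/- arXiv:2211.14833 — 8 statements merged into one kernel-verified Lean document; each statement's English description precedes it below -/
import Mathlib

section
/- Let W ⊆ V with |W| = b, suppose |C_{k+b}(G)| ≥ b, and set m = |C_{k+b}(G)| − b. Define the peeling sequence S₀ = V \ W and S_{t+1} = { i ∈ S_t : i has at least k neighbors in S_t }. Then S_t = C_k(G \ W) for every t ≥ n − b − m; i.e., the deletion cascade stabilizes within at most n − b − m rounds. -/
open Finset

/-- `S` is a `k`-subcore of `G`: every vertex of `S` has at least `k` neighbors inside `S`. -/
def IsKSubcore {V : Type*} [Fintype V] [DecidableEq V] (G : SimpleGraph V)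
    [DecidableRel G.Adj] (k : ℕ) (S : Finset V) : Prop :=
  ∀ i ∈ S, k ≤ (G.neighborFinset i ∩ S).card

/-- The `k`-core of `G \ W` (the subgraph of `G` induced by `V \ W`), regarded as a
subset of `V`: the union of all `k`-subcores of `G` that are disjoint from `W`. -/
noncomputable def kCoreDel {V : Type*} [Fintype V] [DecidableEq V] (G : SimpleGraph V)
    [DecidableRel G.Adj] (k : ℕ) (W : Finset V) : Finset V :=
  @Finset.filter V (fun v => ∃ S : Finset V, IsKSubcore G k S ∧ Disjoint S W ∧ v ∈ S)
    (Classical.decPred _) Finset.univ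

/-- The `k`-core of `G`: the union of all `k`-subcores of `G`. -/
noncomputable def kCore {V : Type*} [Fintype V] [DecidableEq V] (G : SimpleGraph V)
    [DecidableRel G.Adj] (k : ℕ) : Finset V :=
  kCoreDel G k ∅

theorem subcore_sub_del {V : Type*} [Fintype V] [DecidableEq V] (G : SimpleGraph V)
    [DecidableRel G.Adj] (k : ℕ) (W A : Finset V) (hA : IsKSubcore G k A)
    (hd : Disjoint A W) : A ⊆ kCoreDel G k W := by
  intro v hv
  simp only [kCoreDel, Finset.mem_filter, Finset.mem_univ, true_and]
  exact ⟨A, hA, hd, hv⟩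

theorem del_isSubcore {V : Type*} [Fintype V] [DecidableEq V] (G : SimpleGraph V)
    [DecidableRel G.Adj] (k : ℕ) (W : Finset V) : IsKSubcore G k (kCoreDel G k W) := by
  intro v hv
  simp only [kCoreDel, Finset.mem_filter, Finset.mem_univ, true_and] at hv
  obtain ⟨A, hA, hd, hv⟩ := hv
  exact (hA v hv).trans (Finset.card_le_card
    (Finset.inter_subset_inter_left (subcore_sub_del G k W A hA hd)))

theorem del_disjoint {V : Type*} [Fintype V] [DecidableEq V] (G : SimpleGraph V)
    [DecidableRel G.Adj] (k : ℕ) (W : Finset V) : Disjoint (kCoreDel G k W) W := by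
  rw [Finset.disjoint_left]
  intro v hv
  simp only [kCoreDel, Finset.mem_filter, Finset.mem_univ, true_and] at hv
  obtain ⟨A, hA, hd, hv⟩ := hv
  exact Finset.disjoint_left.1 hd hv

/-- with `m = |C_{k+b}(G)| - b ≥ 0`, the peeling sequence started from
`V \ W` (with `|W| = b`) stabilizes at the `k`-core of `G \ W` within at most
`n - b - m` rounds. -/
theorem peeling_del_stabilizes_faster {V : Type*} [Fintype V] [DecidableEq V]
    (G : SimpleGraph V) [DecidableRel G.Adj] (k b : ℕ) (hk : 0 < k) (hb : 0 < b)
    (W : Finset V) (hW : W.card = b)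
    (hcb : b ≤ (kCore G (k + b)).card)
    (m : ℕ) (hm : m = (kCore G (k + b)).card - b)
    (S : ℕ → Finset V)
    (h0 : S 0 = (Finset.univ : Finset V) \ W)
    (hstep : ∀ t, S (t + 1) =
      (S t).filter (fun i => k ≤ (G.neighborFinset i ∩ S t).card)) :
    ∀ t, Fintype.card V - b - m ≤ t → S t = kCoreDel G k W := by
  have hcore : (kCore G (k + b)) \ W ⊆ kCoreDel G k W := by
    apply subcore_sub_del _ _ _ _ _ Finset.sdiff_disjoint
    intro i hi
    have h1 := del_isSubcore G (k + b) ∅ i (Finset.mem_sdiff.1 hi).1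
    have h2 := Finset.le_card_sdiff W (G.neighborFinset i ∩ kCoreDel G (k + b) ∅)
    rw [Finset.inter_sdiff_assoc] at h2
    unfold kCore
    omega
  have hmK : m ≤ (kCoreDel G k W).card := by
    have h1 := Finset.card_le_card hcore
    have h2 := Finset.le_card_sdiff W (kCore G (k + b))
    omega
  have hsub : ∀ t, kCoreDel G k W ⊆ S t := by
    intro t
    induction t with
    | zero =>
      rw [h0]
      intro v hv
      simpa using Finset.disjoint_left.1 (del_disjoint G k W) hv
    | succ t ih =>
      rw [hstep]
      intro v hv
      exact Finset.mem_filter.2 ⟨ih hv, (del_isSubcore G k W v hv).trans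
        (Finset.card_le_card (Finset.inter_subset_inter_left ih))⟩
  have hdis : ∀ t, Disjoint (S t) W := by
    intro t
    induction t with
    | zero => rw [h0]; exact Finset.sdiff_disjoint
    | succ t ih => rw [hstep]; exact ih.mono_left (Finset.filter_subset _ _)
  have hc0 : (S 0).card + b = Fintype.card V := by
    rw [h0, ← hW, Finset.card_sdiff_add_card_eq_card (Finset.subset_univ W), Finset.card_univ]
  have key : ∀ t, IsKSubcore G k (S t) ∨ (S t).card + t ≤ Fintype.card V - b := by
    intro t
    induction t with
    | zero => right; omega
    | succ t ih =>
      by_cases hs : IsKSubcore G k (S t)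
      · left
        have : S (t + 1) = S t := by rw [hstep, Finset.filter_true_of_mem hs]
        rwa [this]
      · right
        have h1 := ih.resolve_left hs
        have h2 : (S (t + 1)).card < (S t).card := by
          rw [hstep]
          apply Finset.card_lt_card
          rw [Finset.filter_ssubset]
          unfold IsKSubcore at hs
          push Not at hs
          obtain ⟨i, hi, h⟩ := hs
          exact ⟨i, hi, by omega⟩
        omega
  intro t ht
  rcases key t with h | h
  · exact Finset.Subset.antisymm (subcore_sub_del G k W _ h (hdis t)) (hsub t)
  · exact (Finset.eq_of_subset_of_card_le (hsub t) (by omega)).symm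
end

section
/- A binary vector u ∈ {0,1}^V satisfies Σ_{j ∈ N(i)} u_j + k − |N(i)| ≤ k·u_i for every i ∈ V if and only if the set { i ∈ V : u_i = 0 } is a k-subcore of G. Consequently, the minimum of Σ_{i ∈ V} u_i over all such binary vectors equals n − |C_k(G)|, where n = |V|. -/
open Finset

theorem sum_add_card_zero {V : Type*} [Fintype V] [DecidableEq V] (u : V → ℤ)
    (hu : ∀ i, u i = 0 ∨ u i = 1) (A : Finset V) :
    (∑ j ∈ A, u j) + ((A ∩ Finset.univ.filter (fun i => u i = 0)).card : ℤ) = (A.card : ℤ) := by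
  have h1 : A ∩ Finset.univ.filter (fun i => u i = 0) = A.filter (fun i => u i = 0) := by
    ext x; simp
  rw [h1, Finset.card_filter, Finset.card_eq_sum_ones]
  push_cast
  rw [← Finset.sum_add_distrib]
  refine Finset.sum_congr rfl fun j _ => ?_
  rcases hu j with h | h <;> simp [h]

theorem binary_iff_subcore {V : Type*} [Fintype V] [DecidableEq V]
    (G : SimpleGraph V) [DecidableRel G.Adj] (k : ℕ) (u : V → ℤ)
    (hu : ∀ i, u i = 0 ∨ u i = 1) :
    (∀ i, (∑ j ∈ G.neighborFinset i, u j) + (k : ℤ) - (G.degree i : ℤ) ≤ (k : ℤ) * u i) ↔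
        IsKSubcore G k (Finset.univ.filter (fun i => u i = 0)) := by
  unfold IsKSubcore
  refine forall_congr' fun i => ?_
  have h := sum_add_card_zero u hu (G.neighborFinset i)
  rw [SimpleGraph.card_neighborFinset_eq_degree] at h
  rcases hu i with h0 | h1
  · simp only [h0, Finset.mem_filter, Finset.mem_univ, true_and, forall_const, mul_zero]
    omega
  · simp only [h1, Finset.mem_filter, Finset.mem_univ, true_and, one_ne_zero, false_imp_iff,
      mul_one, iff_true]
    omega

theorem mem_kCore_iff {V : Type*} [Fintype V] [DecidableEq V]
    (G : SimpleGraph V) [DecidableRel G.Adj] (k : ℕ) (v : V) :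
    v ∈ kCore G k ↔ ∃ S : Finset V, IsKSubcore G k S ∧ v ∈ S := by
  simp [kCore, kCoreDel]

theorem subset_kCore {V : Type*} [Fintype V] [DecidableEq V]
    (G : SimpleGraph V) [DecidableRel G.Adj] (k : ℕ) (S : Finset V) (hS : IsKSubcore G k S) :
    S ⊆ kCore G k := fun v hv => (mem_kCore_iff G k v).2 ⟨S, hS, hv⟩

theorem isKSubcore_kCore {V : Type*} [Fintype V] [DecidableEq V]
    (G : SimpleGraph V) [DecidableRel G.Adj] (k : ℕ) : IsKSubcore G k (kCore G k) := by
  intro i hi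
  obtain ⟨S, hS, hiS⟩ := (mem_kCore_iff G k i).1 hi
  exact (hS i hiS).trans
    (Finset.card_le_card (Finset.inter_subset_inter_left (subset_kCore G k S hS)))

/-- a binary vector `u` satisfies
`∑_{j ∈ N(i)} u j + k - |N(i)| ≤ k·u i` for all `i` iff `{i : u i = 0}` is a
`k`-subcore of `G`; and the minimum of `∑ i, u i` over all such binary vectors equals
`n - |C_k(G)|`. -/
theorem binary_complement_formulation_kCore {V : Type*} [Fintype V] [DecidableEq V]
    (G : SimpleGraph V) [DecidableRel G.Adj] (k : ℕ) (hk : 0 < k) :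
    (∀ u : V → ℤ, (∀ i, u i = 0 ∨ u i = 1) →
      ((∀ i, (∑ j ∈ G.neighborFinset i, u j) + (k : ℤ) - (G.degree i : ℤ) ≤
          (k : ℤ) * u i) ↔
        IsKSubcore G k (Finset.univ.filter (fun i => u i = 0)))) ∧
    IsLeast {s : ℤ | ∃ u : V → ℤ, (∀ i, u i = 0 ∨ u i = 1) ∧
        (∀ i, (∑ j ∈ G.neighborFinset i, u j) + (k : ℤ) - (G.degree i : ℤ) ≤
          (k : ℤ) * u i) ∧ s = ∑ i, u i}
      ((Fintype.card V : ℤ) - ((kCore G k).card : ℤ)) := by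
  refine ⟨fun u hu => binary_iff_subcore G k u hu, ?_, ?_⟩
  · have hu : ∀ i, (fun i => if i ∈ kCore G k then (0 : ℤ) else 1) i = 0 ∨
        (fun i => if i ∈ kCore G k then (0 : ℤ) else 1) i = 1 := by
      intro i
      by_cases h : i ∈ kCore G k <;> simp [h]
    have hz : Finset.univ.filter
        (fun i => (fun i => if i ∈ kCore G k then (0 : ℤ) else 1) i = 0) = kCore G k := by
      ext x; simp
    refine ⟨fun i => if i ∈ kCore G k then (0 : ℤ) else 1, hu, ?_, ?_⟩
    · rw [binary_iff_subcore G k _ hu, hz]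
      exact isKSubcore_kCore G k
    · have h := sum_add_card_zero _ hu Finset.univ
      rw [hz, Finset.univ_inter, Finset.card_univ] at h
      linarith
  · rintro s ⟨u, hu, hc, rfl⟩
    have hs := (binary_iff_subcore G k u hu).1 hc
    have hle := Finset.card_le_card (subset_kCore G k _ hs)
    have h := sum_add_card_zero u hu Finset.univ
    rw [Finset.univ_inter, Finset.card_univ] at h
    omega
end

section
/- Consider the linear program with real variables u_i ∈ [0,1] for each vertex i ∈ V and x_{ij} ∈ [0,1] for each edge {i,j} ∈ E (with x_{ij} = x_{ji}): minimize Σ_{i ∈ V} u_i subject to, for every i ∈ V, Σ_{j ∈ N(i)} u_j + k − |N(i)| ≤ Σ_{j ∈ N(i)} x_{ij} + (k − |N(i)|)·u_i, and for every edge {i,j} ∈ E, x_{ij} ≤ u_i, x_{ij} ≤ u_j, and x_{ij} ≥ u_i + u_j − 1. Then every optimal solution (x*, u*) of this linear program is integer: u*_i ∈ {0,1} for all i ∈ V and x*_{ij} ∈ {0,1} for all {i,j} ∈ E. -/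
open Finset

/-- every optimal solution of the McCormick LP relaxation of the
`k`-core detection problem is integer. -/
theorem lp_relaxation_integral {V : Type*} [Fintype V] [DecidableEq V]
    (G : SimpleGraph V) [DecidableRel G.Adj] (k : ℕ) (hk : 0 < k)
    (u : V → ℝ) (x : V → V → ℝ)
    (hu : ∀ i, 0 ≤ u i ∧ u i ≤ 1)
    (hx : ∀ i j, G.Adj i j → 0 ≤ x i j ∧ x i j ≤ 1)
    (hsym : ∀ i j, G.Adj i j → x i j = x j i)
    (hdeg : ∀ i, (∑ j ∈ G.neighborFinset i, u j) + (k : ℝ) - (G.degree i : ℝ) ≤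
      (∑ j ∈ G.neighborFinset i, x i j) + ((k : ℝ) - (G.degree i : ℝ)) * u i)
    (hmc1 : ∀ i j, G.Adj i j → x i j ≤ u i)
    (hmc2 : ∀ i j, G.Adj i j → x i j ≤ u j)
    (hmc3 : ∀ i j, G.Adj i j → u i + u j - 1 ≤ x i j)
    (hopt : ∀ (u' : V → ℝ) (x' : V → V → ℝ),
      (∀ i, 0 ≤ u' i ∧ u' i ≤ 1) →
      (∀ i j, G.Adj i j → 0 ≤ x' i j ∧ x' i j ≤ 1) →
      (∀ i j, G.Adj i j → x' i j = x' j i) →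
      (∀ i, (∑ j ∈ G.neighborFinset i, u' j) + (k : ℝ) - (G.degree i : ℝ) ≤
        (∑ j ∈ G.neighborFinset i, x' i j) + ((k : ℝ) - (G.degree i : ℝ)) * u' i) →
      (∀ i j, G.Adj i j → x' i j ≤ u' i) →
      (∀ i j, G.Adj i j → x' i j ≤ u' j) →
      (∀ i j, G.Adj i j → u' i + u' j - 1 ≤ x' i j) →
      ∑ i, u i ≤ ∑ i, u' i) :
    (∀ i, u i = 0 ∨ u i = 1) ∧ (∀ i j, G.Adj i j → x i j = 0 ∨ x i j = 1) := by
  classical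
  obtain ⟨w, hw⟩ : ∃ w : V → ℝ, ∀ i, (u i < 1 ∧ w i = 0) ∨ (u i = 1 ∧ w i = 1) := by
    refine ⟨fun i => if u i < 1 then 0 else 1, fun i => ?_⟩
    by_cases h : u i < 1
    · left; simp [h]
    · right; simp only [h, if_false, and_true]
      exact le_antisymm (hu i).2 (not_lt.mp h)
  have hw01 : ∀ i, w i = 0 ∨ w i = 1 := fun i => (hw i).imp And.right And.right
  have hwle : ∀ i, w i ≤ u i := by
    intro i
    rcases hw i with ⟨_, h⟩ | ⟨h1, h⟩
    · rw [h]; exact (hu i).1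
    · rw [h, h1]
  have key : ∑ i, u i ≤ ∑ i, w i := by
    refine hopt w (fun i j => w i * w j) ?_ ?_ ?_ ?_ ?_ ?_ ?_
    · intro i; rcases hw01 i with h | h <;> simp [h]
    · intro i j _; rcases hw01 i with h | h <;> rcases hw01 j with h' | h' <;> simp [h, h']
    · intro i j _; exact mul_comm _ _
    · intro i
      rcases hw i with ⟨hlt, h⟩ | ⟨_, h⟩
      · have h1 : ∑ j ∈ G.neighborFinset i, (1 - u i) * w j
            ≤ ∑ j ∈ G.neighborFinset i, (u j - x i j) := by
          refine Finset.sum_le_sum fun j hj => ?_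
          have hadj : G.Adj i j := by simpa using hj
          rcases hw j with ⟨_, h'⟩ | ⟨h1', h'⟩
          · have := hmc2 i j hadj
            rw [h']; linarith
          · have := hmc1 i j hadj
            rw [h', h1']; linarith
        rw [← Finset.mul_sum, Finset.sum_sub_distrib] at h1
        have h2 := hdeg i
        simp only [h, zero_mul, Finset.sum_const_zero, mul_zero, add_zero]
        by_contra hc
        have h3 := mul_pos (sub_pos.mpr hlt) (not_le.mp hc)
        nlinarith
      · simp only [h, one_mul, mul_one]; linarith
    · intro i j _; rcases hw01 i with h | h <;> rcases hw01 j with h' | h' <;> simp [h, h']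
    · intro i j _; rcases hw01 i with h | h <;> rcases hw01 j with h' | h' <;> simp [h, h']
    · intro i j _; rcases hw01 i with h | h <;> rcases hw01 j with h' | h' <;> simp [h, h']
  have heq : ∀ i, w i = u i := by
    have h := (Finset.sum_eq_sum_iff_of_le (fun i _ => hwle i)).mp
      (le_antisymm (Finset.sum_le_sum fun i _ => hwle i) key)
    exact fun i => h i (Finset.mem_univ i)
  have hu01 : ∀ i, u i = 0 ∨ u i = 1 := fun i => heq i ▸ hw01 i
  refine ⟨hu01, fun i j hadj => ?_⟩
  have a := hmc1 i j hadj
  have b := hmc2 i j hadj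
  have c := hmc3 i j hadj
  have d := hx i j hadj
  rcases hu01 i with h | h
  · left; linarith [d.1]
  · rcases hu01 j with h' | h'
    · left; linarith [d.1]
    · right; linarith [d.2]
end

section
/- Let W ⊆ V. Consider the linear program with real variables u_i ∈ [0,1] for i ∈ V and x_{ij} ≥ 0 for {i,j} ∈ E (with x_{ij} = x_{ji}): minimize Σ_{i ∈ V} u_i subject to, for every i ∈ V, Σ_{j ∈ N(i)} u_j + k − |N(i)| ≤ Σ_{j ∈ N(i)} x_{ij} + (k − |N(i)|)·u_i; for every edge {i,j} ∈ E, x_{ij} ≤ u_i and x_{ij} ≤ u_j; and u_i ≥ 1 for every i ∈ W. The optimal value of this linear program equals n − |C_k(G \ W)|, the number of vertices outside the k-core obtained after removing the interdicted set W. -/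
open Finset

/-- with the interdiction constraints `u i ≥ 1` for `i ∈ W`, the optimal
value of the LP equals `n - |C_k(G \ W)|`. -/
theorem lp_value_eq_complement_collapsed_kCore {V : Type*} [Fintype V] [DecidableEq V]
    (G : SimpleGraph V) [DecidableRel G.Adj] (k : ℕ) (hk : 0 < k) (W : Finset V) :
    IsLeast {s : ℝ | ∃ (u : V → ℝ) (x : V → V → ℝ),
      (∀ i, 0 ≤ u i ∧ u i ≤ 1) ∧
      (∀ i j, G.Adj i j → 0 ≤ x i j) ∧
      (∀ i j, G.Adj i j → x i j = x j i) ∧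
      (∀ i, (∑ j ∈ G.neighborFinset i, u j) + (k : ℝ) - (G.degree i : ℝ) ≤
        (∑ j ∈ G.neighborFinset i, x i j) + ((k : ℝ) - (G.degree i : ℝ)) * u i) ∧
      (∀ i j, G.Adj i j → x i j ≤ u i) ∧
      (∀ i j, G.Adj i j → x i j ≤ u j) ∧
      (∀ i ∈ W, 1 ≤ u i) ∧
      s = ∑ i, u i}
      ((Fintype.card V : ℝ) - ((kCoreDel G k W).card : ℝ)) := by
  classical
  have hmem : ∀ v, v ∈ kCoreDel G k W ↔
      ∃ S : Finset V, IsKSubcore G k S ∧ Disjoint S W ∧ v ∈ S := by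
    intro v
    simp [kCoreDel]
  have hcore : IsKSubcore G k (kCoreDel G k W) := by
    intro i hi
    obtain ⟨S, hS, hd, hiS⟩ := (hmem i).1 hi
    refine (hS i hiS).trans (Finset.card_le_card ?_)
    intro j hj
    rw [Finset.mem_inter] at hj ⊢
    exact ⟨hj.1, (hmem j).2 ⟨S, hS, hd, hj.2⟩⟩
  have hsum : ∀ C : Finset V, ∑ i, (if i ∈ C then (0 : ℝ) else 1)
      = (Fintype.card V : ℝ) - (C.card : ℝ) := by
    intro C
    have h : ∀ i, (if i ∈ C then (0 : ℝ) else 1) = 1 - (if i ∈ C then (1 : ℝ) else 0) := by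
      intro i
      split_ifs <;> norm_num
    simp only [h, Finset.sum_sub_distrib]
    simp
  constructor
  · refine ⟨fun i => if i ∈ kCoreDel G k W then 0 else 1,
      fun i j => (if i ∈ kCoreDel G k W then 0 else 1) *
        (if j ∈ kCoreDel G k W then 0 else 1), ?_, ?_, ?_, ?_, ?_, ?_, ?_, ?_⟩
    · intro i
      dsimp only
      split_ifs <;> norm_num
    · intro i j _
      dsimp only
      split_ifs <;> norm_num
    · intro i j _
      exact mul_comm _ _
    · intro i
      dsimp only
      by_cases hi : i ∈ kCoreDel G k W
      · have h1 : ∑ j ∈ G.neighborFinset i, (if j ∈ kCoreDel G k W then (0 : ℝ) else 1)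
            = (G.degree i : ℝ) - ((G.neighborFinset i ∩ kCoreDel G k W).card : ℝ) := by
          have h : ∀ i, (if i ∈ kCoreDel G k W then (0 : ℝ) else 1)
              = 1 - (if i ∈ kCoreDel G k W then (1 : ℝ) else 0) := by
            intro i
            split_ifs <;> norm_num
          simp only [h, Finset.sum_sub_distrib]
          simp [Finset.filter_mem_eq_inter]
        have h2 : (k : ℝ) ≤ ((G.neighborFinset i ∩ kCoreDel G k W).card : ℝ) := by
          exact_mod_cast hcore i hi
        rw [h1]
        simp only [hi, if_true, zero_mul, mul_zero, Finset.sum_const_zero]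
        linarith
      · simp only [hi, if_false, one_mul, mul_one]
        linarith
    · intro i j _
      dsimp only
      split_ifs <;> norm_num
    · intro i j _
      dsimp only
      split_ifs <;> norm_num
    · intro i hi
      have : i ∉ kCoreDel G k W := by
        intro h
        obtain ⟨S, _, hd, hiS⟩ := (hmem i).1 h
        exact Finset.disjoint_left.1 hd hiS hi
      simp [this]
    · exact (hsum _).symm
  · rintro s ⟨u, x, hu, _, _, hc, hx1, hx2, hW, rfl⟩
    have hsub : IsKSubcore G k (Finset.univ.filter fun i => u i < 1) := by
      intro i hi
      have hi' : u i < 1 := by simpa using hi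
      have hb : ∑ j ∈ G.neighborFinset i, (x i j - u j + (1 - u i))
          ≤ ∑ j ∈ G.neighborFinset i, (if u j < 1 then (1 - u i) else 0) := by
        refine Finset.sum_le_sum fun j hj => ?_
        have hadj : G.Adj i j := by simpa using hj
        have a1 := hx1 i j hadj
        have a2 := hx2 i j hadj
        have a3 := (hu j).2
        split_ifs with h
        · linarith
        · linarith
      have hr : ∑ j ∈ G.neighborFinset i, (if u j < 1 then (1 - u i) else 0)
          = ((G.neighborFinset i ∩ (Finset.univ.filter fun i => u i < 1)).card : ℝ)
            * (1 - u i) := by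
        rw [← Finset.sum_filter, Finset.sum_const, nsmul_eq_mul]
        congr 3
        ext j
        simp
      rw [hr, Finset.sum_add_distrib, Finset.sum_sub_distrib, Finset.sum_const,
        nsmul_eq_mul, G.card_neighborFinset_eq_degree] at hb
      have hci := hc i
      have hpos : 0 < 1 - u i := by linarith
      have : (k : ℝ) * (1 - u i) ≤
          ((G.neighborFinset i ∩ (Finset.univ.filter fun i => u i < 1)).card : ℝ)
            * (1 - u i) := by
        linarith
      exact_mod_cast le_of_mul_le_mul_right this hpos
    rw [← hsum]
    refine Finset.sum_le_sum fun i _ => ?_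
    split_ifs with h
    · exact (hu i).1
    · by_contra hlt
      push Not at hlt
      refine h ((hmem i).2 ⟨_, hsub, ?_, by simpa using hlt⟩)
      rw [Finset.disjoint_left]
      intro j hj hjW
      have h1 : u j < 1 := by simpa using hj
      exact absurd (hW j hjW) (not_le.2 h1)
end

section
/- For every W ⊆ V with |W| ≤ b, the collapsed k-core satisfies |C_k(G \ W)| ≥ |C_{k+b}(G)| − b; i.e., the number m = |C_{k+b}(G)| − b is a valid lower bound on the size of the k-core remaining after removing any set of at most b vertices. -/
open Finset

/-- for every `W` with `|W| ≤ b`, `|C_k(G \ W)| ≥ |C_{k+b}(G)| - b`;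
i.e. `m = |C_{k+b}(G)| - b` is a valid lower bound on the collapsed `k`-core size. -/
theorem collapsed_kCore_lower_bound {V : Type*} [Fintype V] [DecidableEq V]
    (G : SimpleGraph V) [DecidableRel G.Adj] (k b : ℕ) (hk : 0 < k) (hb : 0 < b)
    (W : Finset V) (hW : W.card ≤ b) :
    ((kCore G (k + b)).card : ℤ) - (b : ℤ) ≤ ((kCoreDel G k W).card : ℤ) := by
  have hsub : kCore G (k + b) \ W ⊆ kCoreDel G k W := by
    intro v hv
    simp only [kCore, kCoreDel, Finset.mem_sdiff, Finset.mem_filter, Finset.mem_univ,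
      true_and] at hv ⊢
    obtain ⟨⟨S, hS, -, hvS⟩, hvW⟩ := hv
    refine ⟨S \ W, ?_, Finset.sdiff_disjoint, Finset.mem_sdiff.2 ⟨hvS, hvW⟩⟩
    intro i hi
    have h1 := hS i (Finset.mem_sdiff.1 hi).1
    have h2 : G.neighborFinset i ∩ (S \ W) = (G.neighborFinset i ∩ S) \ W := by
      ext x
      simp only [Finset.mem_inter, Finset.mem_sdiff, and_assoc]
    rw [h2]
    have h3 := Finset.le_card_sdiff W (G.neighborFinset i ∩ S)
    omega
  have h4 := Finset.card_le_card hsub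
  have h5 := Finset.le_card_sdiff W (kCore G (k + b))
  omega
end

section
/- Let h ≥ k be integers, let K ⊆ V be such that every vertex of K has at least h neighbors in K, and let W ⊆ V with |K ∩ W| ≤ h − k. Then K \ W is a k-subcore of G \ W, and hence |C_k(G \ W)| ≥ |K| − (h − k). (This establishes the validity of the h-subcore cuts used to strengthen the sparse formulation.) -/
open Finset

/-- if `K` is an `h`-subcore with `h ≥ k` and at most `h - k` of its
vertices are interdicted, then `K \ W` is a `k`-subcore of `G \ W`, hence
`|C_k(G \ W)| ≥ |K| - (h - k)`. -/
theorem hSubcore_cut_valid {V : Type*} [Fintype V] [DecidableEq V]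
    (G : SimpleGraph V) [DecidableRel G.Adj] (k h : ℕ) (hk : 0 < k) (hkh : k ≤ h)
    (K W : Finset V) (hK : IsKSubcore G h K) (hKW : (K ∩ W).card ≤ h - k) :
    IsKSubcore G k (K \ W) ∧ Disjoint (K \ W) W ∧
      ((K.card : ℤ) - ((h - k : ℕ) : ℤ) ≤ ((kCoreDel G k W).card : ℤ)) := by
  have h1 : IsKSubcore G k (K \ W) := by
    intro i hi
    have hd := hK i (Finset.mem_sdiff.mp hi).1
    have hsub : G.neighborFinset i ∩ K ⊆ (G.neighborFinset i ∩ (K \ W)) ∪ (K ∩ W) := by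
      intro x hx
      simp only [Finset.mem_union, Finset.mem_inter, Finset.mem_sdiff] at hx ⊢
      tauto
    have h2 := (Finset.card_le_card hsub).trans (Finset.card_union_le _ _)
    omega
  have h2 : Disjoint (K \ W) W := Finset.sdiff_disjoint
  refine ⟨h1, h2, ?_⟩
  have h3 : K \ W ⊆ kCoreDel G k W := by
    intro x hx
    unfold kCoreDel
    classical
    simp only [Finset.mem_filter]
    exact ⟨Finset.mem_univ _, _, h1, h2, hx⟩
  have h4 := Finset.card_le_card h3
  have h5 := Finset.card_sdiff_add_card_inter K W
  omega
end

section
/- Let u ∈ V and let j be a follower of u distinct from u, i.e., j ≠ u and j ∉ C_k(G \ {u}). Then for every W ⊆ V with j ∈ W and u ∉ W, one has C_k(G \ ((W \ {j}) ∪ {u})) ⊆ C_k(G \ W); in particular |C_k(G \ ((W \ {j}) ∪ {u}))| ≤ |C_k(G \ W)|, so replacing the collapser j by u never increases the size of the resulting k-core. -/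
open Finset

/-- if `j ≠ u` is a follower of `u` (i.e. `j ∉ C_k(G \ {u})`), then
replacing the collapser `j` by `u` in any interdiction set `W` never increases the
resulting `k`-core: `C_k(G \ ((W \ {j}) ∪ {u})) ⊆ C_k(G \ W)`. -/
theorem replace_follower_by_leader {V : Type*} [Fintype V] [DecidableEq V]
    (G : SimpleGraph V) [DecidableRel G.Adj] (k : ℕ) (hk : 0 < k)
    (u j : V) (hne : j ≠ u) (hj : j ∉ kCoreDel G k {u})
    (W : Finset V) (hjW : j ∈ W) (huW : u ∉ W) :
    kCoreDel G k ((W \ {j}) ∪ {u}) ⊆ kCoreDel G k W ∧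
      (kCoreDel G k ((W \ {j}) ∪ {u})).card ≤ (kCoreDel G k W).card := by
  have h : kCoreDel G k ((W \ {j}) ∪ {u}) ⊆ kCoreDel G k W := by
    intro v hv
    simp only [kCoreDel, Finset.mem_filter, Finset.mem_univ, true_and] at hv hj ⊢
    obtain ⟨S, hS, hd, hvS⟩ := hv
    rw [Finset.disjoint_union_right] at hd
    have hjS : j ∉ S := fun hjS => hj ⟨S, hS, hd.2, hjS⟩
    refine ⟨S, hS, ?_, hvS⟩
    rw [Finset.disjoint_left]
    intro a haS haW
    have haj : a ≠ j := fun e => hjS (e ▸ haS)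
    exact Finset.disjoint_left.mp hd.1 haS (by simp [haW, haj])
  exact ⟨h, Finset.card_le_card h⟩
end

section
/- Suppose J_i ⊆ J_j, i.e., every vertex leaving the network when i is removed also leaves when j is removed. Then for every W ⊆ V with i ∈ W and j ∉ W, one has |C_k(G \ ((W \ {i}) ∪ {j}))| ≤ |C_k(G \ W)|; hence there always exists an optimal interdiction set of any given size b in which j is removed whenever i is (validity of the dominance inequalities w_j ≥ w_i). -/
open Finset

/-- if `J_i ⊆ J_j` (every vertex leaving when `i` is removed also
leaves when `j` is removed), then replacing `i` by `j` in an interdiction set never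
increases the resulting `k`-core; hence for every size `b` there is an optimal
interdiction set in which `j` is removed whenever `i` is. -/
theorem dominance_inequalities_valid {V : Type*} [Fintype V] [DecidableEq V]
    (G : SimpleGraph V) [DecidableRel G.Adj] (k b : ℕ) (hk : 0 < k)
    (hb : b ≤ Fintype.card V) (i j : V)
    (hJ : (Finset.univ : Finset V) \ kCoreDel G k {i} ⊆
      (Finset.univ : Finset V) \ kCoreDel G k {j}) :
    (∀ W : Finset V, i ∈ W → j ∉ W →
      (kCoreDel G k ((W \ {i}) ∪ {j})).card ≤ (kCoreDel G k W).card) ∧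
    ∃ W : Finset V, W.card = b ∧
      (∀ W' : Finset V, W'.card = b →
        (kCoreDel G k W).card ≤ (kCoreDel G k W').card) ∧
      (i ∈ W → j ∈ W) := by
  have key : ∀ S : Finset V, IsKSubcore G k S → j ∉ S → i ∉ S := by
    intro S hS hj hi
    have h1 : i ∈ (Finset.univ : Finset V) \ kCoreDel G k {i} := by
      simp only [kCoreDel, Finset.mem_sdiff, Finset.mem_univ, Finset.mem_filter, true_and]
      rintro ⟨T, -, hd, hiT⟩
      exact (Finset.disjoint_singleton_right.mp hd) hiT
    have h2 := (Finset.mem_sdiff.mp (hJ h1)).2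
    apply h2
    simp only [kCoreDel, Finset.mem_univ, Finset.mem_filter, true_and]
    exact ⟨S, hS, Finset.disjoint_singleton_right.mpr hj, hi⟩
  have main : ∀ W : Finset V, i ∈ W → j ∉ W →
      (kCoreDel G k ((W \ {i}) ∪ {j})).card ≤ (kCoreDel G k W).card := by
    intro W _ _
    apply Finset.card_le_card
    intro v hv
    simp only [kCoreDel, Finset.mem_univ, Finset.mem_filter, true_and] at hv ⊢
    obtain ⟨S, hS, hd, hvS⟩ := hv
    refine ⟨S, hS, ?_, hvS⟩
    rw [Finset.disjoint_union_right, Finset.disjoint_singleton_right] at hd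
    have hiS := key S hS hd.2
    rw [Finset.disjoint_left]
    intro x hx hxW
    refine Finset.disjoint_left.mp hd.1 hx (Finset.mem_sdiff.mpr ⟨hxW, ?_⟩)
    intro hxi
    exact hiS (Finset.mem_singleton.mp hxi ▸ hx)
  refine ⟨main, ?_⟩
  have hne : (Finset.powersetCard b (Finset.univ : Finset V)).Nonempty :=
    Finset.powersetCard_nonempty.mpr (by simpa using hb)
  obtain ⟨W, hW, hmin⟩ := Finset.exists_min_image _ (fun W => (kCoreDel G k W).card) hne
  have hWb : W.card = b := (Finset.mem_powersetCard.mp hW).2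
  have hmin' : ∀ W' : Finset V, W'.card = b →
      (kCoreDel G k W).card ≤ (kCoreDel G k W').card := fun W' h =>
    hmin W' (Finset.mem_powersetCard.mpr ⟨Finset.subset_univ _, h⟩)
  by_cases h : i ∈ W ∧ j ∉ W
  · refine ⟨(W \ {i}) ∪ {j}, ?_, fun W' h' => (main W h.1 h.2).trans (hmin' W' h'), ?_⟩
    · rw [Finset.card_union_of_disjoint, Finset.card_singleton, Finset.sdiff_singleton_eq_erase,
        Finset.card_erase_add_one h.1, hWb]
      rw [Finset.disjoint_singleton_right]
      exact fun hj => h.2 (Finset.mem_sdiff.mp hj).1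
    · intro _
      simp
  · exact ⟨W, hWb, hmin', fun hi => by_contra fun hj => h ⟨hi, hj⟩⟩
end
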